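/- arXiv:1511.08889 — 3 statements merged into one kernel-verified Lean document; each statement's English description precedes it below -/
import Mathlib

section
/- Let C be a binary linear code of length n and C⊥ its dual. Then for all real numbers a, b, c, d: J(C, C⊥)(a, b, c, d) = (1/2^n) · J(C, C⊥)(a+b+c+d, a+b−c−d, a−b+c−d, a−b−c+d). -/
open Finset

/-- The dual of a binary linear code `C ≤ GF(2)^n`. -/
def dualCode {n : ℕ} (C : Submodule (ZMod 2) (Fin n → ZMod 2)) :
    Submodule (ZMod 2) (Fin n → ZMod 2) where
  carrier := {y | ∀ x ∈ C, ∑ i, x i * y i = 0}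
  zero_mem' := by intro x hx; simp
  add_mem' := by
    intro a b ha hb x hx
    have h1 := ha x hx
    have h2 := hb x hx
    simp only [Set.mem_setOf_eq] at *
    simp [Pi.add_apply, mul_add, Finset.sum_add_distrib, h1, h2]
  smul_mem' := by
    intro c y hy x hx
    have h1 := hy x hx
    simp only [Set.mem_setOf_eq] at *
    simp [Pi.smul_apply, smul_eq_mul, mul_left_comm, ← Finset.mul_sum, h1]

/-- Number of coordinates where `(u i, v i) = (0,0)`. -/
def patI {n : ℕ} (u v : Fin n → ZMod 2) : ℕ :=
  (Finset.univ.filter fun i => u i = 0 ∧ v i = 0).card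

/-- Number of coordinates where `(u i, v i) = (0,1)`. -/
def patJ {n : ℕ} (u v : Fin n → ZMod 2) : ℕ :=
  (Finset.univ.filter fun i => u i = 0 ∧ v i = 1).card

/-- Number of coordinates where `(u i, v i) = (1,0)`. -/
def patK {n : ℕ} (u v : Fin n → ZMod 2) : ℕ :=
  (Finset.univ.filter fun i => u i = 1 ∧ v i = 0).card

/-- Number of coordinates where `(u i, v i) = (1,1)`. -/
def patL {n : ℕ} (u v : Fin n → ZMod 2) : ℕ :=
  (Finset.univ.filter fun i => u i = 1 ∧ v i = 1).card

/-- Hamming weight of a binary vector. -/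
def wt {n : ℕ} (u : Fin n → ZMod 2) : ℕ :=
  (Finset.univ.filter fun i => u i ≠ 0).card

noncomputable instance {n : ℕ} (C : Submodule (ZMod 2) (Fin n → ZMod 2)) :
    Fintype C := Fintype.ofFinite C

/-- Joint weight enumerator of two binary linear codes. -/
noncomputable def jwe {n : ℕ} (A B : Submodule (ZMod 2) (Fin n → ZMod 2))
    (a b c d : ℝ) : ℝ :=
  ∑ u : A, ∑ v : B,
    a ^ patI (u : Fin n → ZMod 2) (v : Fin n → ZMod 2) *
    b ^ patJ (u : Fin n → ZMod 2) (v : Fin n → ZMod 2) *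
    c ^ patK (u : Fin n → ZMod 2) (v : Fin n → ZMod 2) *
    d ^ patL (u : Fin n → ZMod 2) (v : Fin n → ZMod 2)

/-- Weight enumerator of a binary linear code of length `n`. -/
noncomputable def wenum {n : ℕ} (D : Submodule (ZMod 2) (Fin n → ZMod 2))
    (x y : ℝ) : ℝ :=
  ∑ u : D, x ^ (n - wt (u : Fin n → ZMod 2)) * y ^ wt (u : Fin n → ZMod 2)

/-- Weight distribution of a binary linear code. -/
noncomputable def wdist {n : ℕ} (D : Submodule (ZMod 2) (Fin n → ZMod 2)) (i : ℕ) : ℕ :=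
  Nat.card {u : D // wt (u : Fin n → ZMod 2) = i}

/-- Joint pattern counts `M(i,j,k,l)` for a pair of codes. -/
noncomputable def Mcount {n : ℕ} (C D : Submodule (ZMod 2) (Fin n → ZMod 2))
    (i j k l : ℕ) : ℕ :=
  Nat.card {p : C × D //
    patI (p.1 : Fin n → ZMod 2) (p.2 : Fin n → ZMod 2) = i ∧
    patJ (p.1 : Fin n → ZMod 2) (p.2 : Fin n → ZMod 2) = j ∧
    patK (p.1 : Fin n → ZMod 2) (p.2 : Fin n → ZMod 2) = k ∧
    patL (p.1 : Fin n → ZMod 2) (p.2 : Fin n → ZMod 2) = l}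


noncomputable def chi (x : ZMod 2) : ℝ := if x = 0 then 1 else -1

lemma zmod2_cases (x : ZMod 2) : x = 0 ∨ x = 1 := by revert x; decide

lemma chi_add (x y : ZMod 2) : chi (x + y) = chi x * chi y := by
  have h : (1 : ZMod 2) + 1 = 0 := by decide
  rcases zmod2_cases x with rfl | rfl <;> rcases zmod2_cases y with rfl | rfl <;> simp [chi, h]

lemma chi_sum {ι : Type*} (s : Finset ι) (g : ι → ZMod 2) :
    chi (∑ i ∈ s, g i) = ∏ i ∈ s, chi (g i) := by
  classical
  induction s using Finset.induction_on with
  | empty => simp [chi]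
  | insert a s ha ih => rw [sum_insert ha, prod_insert ha, chi_add, ih]

lemma mem_dual {n : ℕ} (C : Submodule (ZMod 2) (Fin n → ZMod 2)) (y : Fin n → ZMod 2) :
    y ∈ dualCode C ↔ ∀ x ∈ C, ∑ i, x i * y i = 0 := Iff.rfl

open Classical in
lemma sum_chi {n : ℕ} (D : Submodule (ZMod 2) (Fin n → ZMod 2)) (w : Fin n → ZMod 2) :
    ∑ u : D, chi (∑ i, (u : Fin n → ZMod 2) i * w i) =
      if w ∈ dualCode D then (Fintype.card D : ℝ) else 0 := by
  split_ifs with h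
  · have : ∀ u : D, chi (∑ i, (u : Fin n → ZMod 2) i * w i) = 1 := by
      intro u
      rw [(mem_dual D w).1 h u u.2]; simp [chi]
    simp [this]
  · rw [mem_dual] at h
    push Not at h
    obtain ⟨x, hx, hne⟩ := h
    have key := Equiv.sum_comp (Equiv.addRight (⟨x, hx⟩ : D))
      (fun u : D => chi (∑ i, (u : Fin n → ZMod 2) i * w i))
    have : ∀ u : D, chi (∑ i, ((Equiv.addRight (⟨x, hx⟩ : D) u : D) : Fin n → ZMod 2) i * w i)
        = - chi (∑ i, (u : Fin n → ZMod 2) i * w i) := by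
      intro u
      have h2 : chi (∑ i, x i * w i) = -1 := by simp [chi, hne]
      simp only [Equiv.coe_addRight, Submodule.coe_add, Pi.add_apply, add_mul,
        sum_add_distrib, chi_add, h2]
      ring
    simp only [this, sum_neg_distrib] at key
    linarith

lemma sum_sub {n : ℕ} (D : Submodule (ZMod 2) (Fin n → ZMod 2)) (g : (Fin n → ZMod 2) → ℝ)
    [DecidablePred (· ∈ D)] :
    ∑ u : D, g u = ∑ u, if u ∈ D then g u else 0 := by
  rw [← sum_filter]
  exact (sum_subtype _ (by simp) g).symm

lemma card_mul {n : ℕ} (C : Submodule (ZMod 2) (Fin n → ZMod 2)) :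
    (Fintype.card C : ℝ) * Fintype.card (dualCode C) = 2 ^ n := by
  classical
  have h1 : ∑ v : Fin n → ZMod 2, ∑ u : C, chi (∑ i, (u : Fin n → ZMod 2) i * v i)
      = (Fintype.card C : ℝ) * Fintype.card (dualCode C) := by
    simp only [sum_chi]
    rw [← sum_sub (dualCode C) (fun _ => (Fintype.card C : ℝ))]
    simp [mul_comm]
  have h2 : ∀ u : Fin n → ZMod 2, ∑ v : Fin n → ZMod 2, chi (∑ i, u i * v i)
      = if u = 0 then 2 ^ n else 0 := by
    intro u
    have h := sum_chi (⊤ : Submodule (ZMod 2) (Fin n → ZMod 2)) u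
    have h4 : Fintype.card (⊤ : Submodule (ZMod 2) (Fin n → ZMod 2)) = 2 ^ n := by
      rw [Fintype.card_congr (Submodule.topEquiv (R := ZMod 2) (M := Fin n → ZMod 2)).toEquiv]
      simp [ZMod.card]
    rw [h4] at h
    rw [sum_sub ⊤ (fun v => chi (∑ i, v i * u i))] at h
    simp only [Submodule.mem_top, if_true] at h
    simp only [mul_comm (u _)]
    rw [h]
    have h3 : u ∈ dualCode (⊤ : Submodule (ZMod 2) (Fin n → ZMod 2)) ↔ u = 0 := by
      rw [mem_dual]
      constructor
      · intro h
        ext i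
        simpa [Pi.single_apply] using h (Pi.single i 1) trivial
      · rintro rfl; simp
    simp only [h3]
    push_cast
    rfl
  rw [← h1, sum_comm]
  simp only [h2]
  rw [sum_sub C (fun u => if u = 0 then (2 : ℝ) ^ n else 0), sum_eq_single 0]
  · simp
  · intro b _ hb; simp [hb]
  · simp

lemma dual_dual {n : ℕ} (C : Submodule (ZMod 2) (Fin n → ZMod 2)) :
    dualCode (dualCode C) = C := by
  have hle : C ≤ dualCode (dualCode C) := by
    intro x hx
    rw [mem_dual]
    intro y hy
    simpa [mul_comm] using (mem_dual C y).1 hy x hx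
  have h1 := card_mul C
  have h2 := card_mul (dualCode C)
  have hpos : (0 : ℝ) < Fintype.card (dualCode C) := by
    exact_mod_cast Fintype.card_pos
  have h3 : (Fintype.card C : ℝ) = Fintype.card (dualCode (dualCode C)) := by
    apply mul_right_cancel₀ hpos.ne'
    rw [h1, ← h2, mul_comm]
  have h4 : Fintype.card C = Fintype.card (dualCode (dualCode C)) := by exact_mod_cast h3
  symm
  apply SetLike.coe_injective
  apply Set.eq_of_subset_of_ncard_le hle _ (Set.toFinite _)
  rw [← Nat.card_coe_set_eq, ← Nat.card_coe_set_eq]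
  have := Nat.card_eq_fintype_card (α := C)
  have := Nat.card_eq_fintype_card (α := dualCode (dualCode C))
  simp only [SetLike.coe_sort_coe]
  omega

noncomputable def ff (a b c d : ℝ) (x y : ZMod 2) : ℝ :=
  if x = 0 then (if y = 0 then a else b) else (if y = 0 then c else d)

lemma pat_prod {n : ℕ} (u v : Fin n → ZMod 2) (a b c d : ℝ) :
    a ^ patI u v * b ^ patJ u v * c ^ patK u v * d ^ patL u v = ∏ i, ff a b c d (u i) (v i) := by
  simp only [patI, patJ, patK, patL, ← prod_const, prod_filter, ← prod_mul_distrib]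
  refine prod_congr rfl fun i _ => ?_
  rcases zmod2_cases (u i) with h | h <;> rcases zmod2_cases (v i) with h' | h' <;>
    simp [ff, h, h']

lemma ff_transform (a b c d : ℝ) (x y : ZMod 2) :
    ff (a + b + c + d) (a + b - c - d) (a - b + c - d) (a - b - c + d) x y =
      ∑ x' : ZMod 2, ∑ y' : ZMod 2, chi (x * y') * chi (y * x') * ff a b c d x' y' := by
  have hs : ∀ g : ZMod 2 → ℝ, ∑ x, g x = g 0 + g 1 := fun g => Fin.sum_univ_two g
  simp only [hs]
  rcases zmod2_cases x with rfl | rfl <;> rcases zmod2_cases y with rfl | rfl <;>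
    simp [ff, chi] <;> ring

lemma prod_transform {n : ℕ} (u v : Fin n → ZMod 2) (a b c d : ℝ) :
    ∏ i, ff (a + b + c + d) (a + b - c - d) (a - b + c - d) (a - b - c + d) (u i) (v i) =
      ∑ u' : Fin n → ZMod 2, ∑ v' : Fin n → ZMod 2,
        chi (∑ i, u i * v' i) * chi (∑ i, v i * u' i) * ∏ i, ff a b c d (u' i) (v' i) := by
  simp only [ff_transform, prod_univ_sum, Fintype.piFinset_univ, chi_sum, prod_mul_distrib]

theorem stmt3 {n : ℕ} (C : Submodule (ZMod 2) (Fin n → ZMod 2)) (a b c d : ℝ) :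
    jwe C (dualCode C) a b c d =
      (1 / 2 ^ n) *
        jwe C (dualCode C) (a + b + c + d) (a + b - c - d) (a - b + c - d) (a - b - c + d) := by
  classical
  have hne : (2 : ℝ) ^ n ≠ 0 := by positivity
  simp only [jwe, pat_prod, prod_transform]
  have key : ∑ u : C, ∑ v : dualCode C, ∑ u' : Fin n → ZMod 2, ∑ v' : Fin n → ZMod 2,
        chi (∑ i, (u : Fin n → ZMod 2) i * v' i) * chi (∑ i, (v : Fin n → ZMod 2) i * u' i) *
          ∏ i, ff a b c d (u' i) (v' i) =
      ∑ u' : Fin n → ZMod 2, ∑ v' : Fin n → ZMod 2,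
        (∑ u : C, chi (∑ i, (u : Fin n → ZMod 2) i * v' i)) *
        (∑ v : dualCode C, chi (∑ i, (v : Fin n → ZMod 2) i * u' i)) *
          ∏ i, ff a b c d (u' i) (v' i) := by
    simp only [sum_mul]
    calc _ = ∑ u : C, ∑ u' : Fin n → ZMod 2, ∑ v : dualCode C, ∑ v' : Fin n → ZMod 2,
        chi (∑ i, (u : Fin n → ZMod 2) i * v' i) * chi (∑ i, (v : Fin n → ZMod 2) i * u' i) *
          ∏ i, ff a b c d (u' i) (v' i) := sum_congr rfl fun _ _ => sum_comm
      _ = _ := by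
        rw [sum_comm]
        refine sum_congr rfl fun u' _ => ?_
        rw [sum_comm (s := (univ : Finset (Fin n → ZMod 2)))]
        refine sum_congr rfl fun u _ => ?_
        rw [sum_comm]
        simp only [mul_sum, sum_mul]
  rw [key]
  simp only [sum_chi, dual_dual]
  rw [sum_sub C (fun u => ∑ v : dualCode C, ∏ i, ff a b c d (u i) ((v : Fin n → ZMod 2) i)),
    mul_sum]
  refine sum_congr rfl fun u _ => ?_
  rw [sum_sub (dualCode C) (fun v => ∏ i, ff a b c d (u i) (v i)), mul_sum]
  by_cases hu : u ∈ C
  · simp only [hu, if_true]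
    refine sum_congr rfl fun v _ => ?_
    by_cases hv : v ∈ dualCode C
    · simp only [hv, if_true, card_mul]
      field_simp
    · simp [hv]
  · simp [hu]
end

section
/- Let C be a binary linear code of length n and dimension k, and C⊥ its dual. Then for all real numbers x, y, the MacWilliams identity holds: w_{C⊥}(x, y) = (1/2^k) · w_C(x+y, x−y). -/
open Finset

def mwChi (a : ZMod 2) : ℝ := if a = 0 then 1 else -1

lemma mwChi_add (a b : ZMod 2) : mwChi (a + b) = mwChi a * mwChi b := by
  have h11 : (1 + 1 : ZMod 2) = 0 := by decide
  have hc : ∀ c : ZMod 2, c = 0 ∨ c = 1 := by decide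
  rcases hc a with rfl | rfl <;> rcases hc b with rfl | rfl <;> simp [mwChi, h11]

lemma mwChi_sum {ι : Type*} (s : Finset ι) (f : ι → ZMod 2) :
    mwChi (∑ i ∈ s, f i) = ∏ i ∈ s, mwChi (f i) := by
  classical
  induction s using Finset.induction_on with
  | empty => simp [mwChi]
  | insert a s ha ih => rw [Finset.sum_insert ha, Finset.prod_insert ha, mwChi_add, ih]

lemma mw_weight {n : ℕ} (u : Fin n → ZMod 2) (x y : ℝ) :
    x ^ (n - wt u) * y ^ wt u = ∏ i, (if u i = 0 then x else y) := by
  rw [Finset.prod_ite, Finset.prod_const, Finset.prod_const]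
  have h := Finset.card_filter_add_card_filter_not (s := (Finset.univ : Finset (Fin n)))
    (fun i => u i = 0)
  rw [Finset.card_univ, Fintype.card_fin] at h
  have h2 : n - wt u = (Finset.univ.filter fun i => u i = 0).card := by
    unfold wt
    simp only [ne_eq]
    omega
  rw [h2]
  rfl

lemma mw_inner {n : ℕ} (u : Fin n → ZMod 2) (x y : ℝ) :
    ∑ v : Fin n → ZMod 2, mwChi (∑ i, u i * v i) * ∏ i, (if v i = 0 then x else y)
      = ∏ i, (if u i = 0 then x + y else x - y) := by
  have h : ∀ i, (if u i = 0 then x + y else x - y)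
      = ∑ a : ZMod 2, mwChi (u i * a) * (if a = 0 then x else y) := by
    intro i
    have : (Finset.univ : Finset (ZMod 2)) = {0, 1} := by decide
    rw [this, Finset.sum_pair (by decide)]
    by_cases h0 : u i = 0 <;> simp [mwChi, h0, sub_eq_add_neg]
  simp_rw [h]
  rw [Fintype.prod_sum]
  simp_rw [mwChi_sum, Finset.prod_mul_distrib]

lemma mw_char {n : ℕ} (C : Submodule (ZMod 2) (Fin n → ZMod 2)) (v : Fin n → ZMod 2)
    [Decidable (v ∈ dualCode C)] :
    ∑ u : C, mwChi (∑ i, (u : Fin n → ZMod 2) i * v i)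
      = if v ∈ dualCode C then (2 : ℝ) ^ Module.finrank (ZMod 2) C else 0 := by
  split_ifs with h
  · have h' : ∀ u : C, mwChi (∑ i, (u : Fin n → ZMod 2) i * v i) = 1 := by
      intro u
      have := h u.1 u.2
      rw [this]; simp [mwChi]
    simp_rw [h']
    have hc := Module.card_eq_pow_finrank (K := ZMod 2) (V := C)
    rw [ZMod.card] at hc
    simp [hc]
  · have : ∃ w ∈ C, ∑ i, w i * v i ≠ 0 := by
      by_contra hh
      push Not at hh
      exact h hh
    obtain ⟨w, hw, hne⟩ := this
    have e := Equiv.sum_comp (Equiv.addRight (⟨w, hw⟩ : C))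
      (fun u : C => mwChi (∑ i, (u : Fin n → ZMod 2) i * v i))
    simp only [Equiv.coe_addRight, Submodule.coe_add, Pi.add_apply, add_mul,
      Finset.sum_add_distrib, mwChi_add] at e
    rw [← Finset.sum_mul] at e
    have : mwChi (∑ i, w i * v i) = -1 := by simp [mwChi, hne]
    rw [this] at e
    linarith

theorem stmt9 {n k : ℕ} (C : Submodule (ZMod 2) (Fin n → ZMod 2))
    (hk : Module.finrank (ZMod 2) C = k) (x y : ℝ) :
    wenum (dualCode C) x y = (1 / 2 ^ k) * wenum C (x + y) (x - y) := by
  classical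
  have key : wenum C (x + y) (x - y) = 2 ^ k * wenum (dualCode C) x y := by
    unfold wenum
    simp_rw [mw_weight, ← mw_inner]
    rw [Finset.sum_comm]
    simp_rw [← Finset.sum_mul, mw_char, hk, ite_mul, zero_mul]
    rw [← Finset.sum_filter, Finset.mul_sum]
    exact Finset.sum_subtype _ (by simp)
      (fun v : Fin n → ZMod 2 => (2 : ℝ) ^ k * ∏ i, (if v i = 0 then x else y))
  rw [key]
  field_simp
end

section
/- Let C be a binary linear code of length n and dimension k, with weight distributions A_j of C and B_i of C⊥. Then for every i with 0 ≤ i ≤ n: B_i = 2^{−k} · Σ_{j=0}^{n} A_j · P_i(j), where P_i(j) = Σ_{s=0}^{i} (−1)^s C(j, s) C(n−j, i−s) is the i-th Krawtchuk polynomial evaluated at j. -/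
open Finset

noncomputable def chi2 (a : ZMod 2) : ℝ := if a = 0 then 1 else -1

theorem chi2_zero : chi2 0 = 1 := by simp [chi2]

theorem chi2_add (a b : ZMod 2) : chi2 (a + b) = chi2 a * chi2 b := by
  have h11 : (1 : ZMod 2) + 1 = 0 := by decide
  have hd : ∀ a : ZMod 2, a = 0 ∨ a = 1 := by decide
  rcases hd a with rfl | rfl <;> rcases hd b with rfl | rfl <;> simp [chi2, h11]

theorem chi2_sum {ι : Type*} (s : Finset ι) (f : ι → ZMod 2) :
    chi2 (∑ t ∈ s, f t) = ∏ t ∈ s, chi2 (f t) := by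
  classical
  induction s using Finset.induction_on with
  | empty => simp [chi2_zero]
  | insert a s ha ih => rw [Finset.sum_insert ha, Finset.prod_insert ha, chi2_add, ih]

theorem coeff_one_sub_X_pow' (j s : ℕ) :
    ((1 - Polynomial.X : Polynomial ℝ) ^ j).coeff s = (-1) ^ s * (Nat.choose j s : ℝ) := by
  have h : (1 - Polynomial.X : Polynomial ℝ) ^ j
      = ((1 + Polynomial.X : Polynomial ℝ) ^ j).comp (Polynomial.C (-1) * Polynomial.X) := by
    simp [sub_eq_add_neg]
  rw [h, Polynomial.comp_C_mul_X_coeff, Polynomial.coeff_one_add_X_pow]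
  ring

theorem wt_le' {n : ℕ} (u : Fin n → ZMod 2) : wt u ≤ n := by
  unfold wt
  exact (Finset.card_filter_le _ _).trans (by simp)

theorem gen_kraw {n : ℕ} (u : Fin n → ZMod 2) :
    ∑ v : Fin n → ZMod 2, Polynomial.C (chi2 (∑ t, u t * v t)) * Polynomial.X ^ wt v
      = (1 - Polynomial.X : Polynomial ℝ) ^ wt u * (1 + Polynomial.X) ^ (n - wt u) := by
  have h1 : ∀ v : Fin n → ZMod 2,
      (Polynomial.C (chi2 (∑ t, u t * v t)) * Polynomial.X ^ wt v : Polynomial ℝ)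
      = ∏ t, (Polynomial.C (chi2 (u t * v t)) * (if v t ≠ 0 then Polynomial.X else 1)) := by
    intro v
    rw [Finset.prod_mul_distrib, chi2_sum, map_prod, Finset.prod_ite]
    simp [wt]
  have h2 : ∀ t, (∑ a : ZMod 2, (Polynomial.C (chi2 (u t * a)) *
      (if a ≠ 0 then Polynomial.X else 1) : Polynomial ℝ))
      = if u t ≠ 0 then 1 - Polynomial.X else 1 + Polynomial.X := by
    intro t
    have : (∑ a : ZMod 2, (Polynomial.C (chi2 (u t * a)) *
      (if a ≠ 0 then Polynomial.X else 1) : Polynomial ℝ))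
      = Polynomial.C (chi2 (u t * 0)) * (if (0 : ZMod 2) ≠ 0 then Polynomial.X else 1)
       + Polynomial.C (chi2 (u t * 1)) * (if (1 : ZMod 2) ≠ 0 then Polynomial.X else 1) :=
      Fin.sum_univ_two _
    rw [this]
    by_cases h : u t = 0
    · simp [h, chi2]
    · simp [h, chi2, sub_eq_add_neg]
  simp_rw [h1]
  have h3 := Finset.prod_univ_sum (fun _ : Fin n => (Finset.univ : Finset (ZMod 2)))
    (fun t a => (Polynomial.C (chi2 (u t * a)) *
      (if a ≠ 0 then Polynomial.X else 1) : Polynomial ℝ))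
  rw [Fintype.piFinset_univ] at h3
  rw [← h3]
  simp_rw [h2]
  rw [Finset.prod_ite, Finset.prod_const, Finset.prod_const]
  have h4 : (Finset.univ.filter fun t => ¬ (u t ≠ 0)).card = n - wt u := by
    have := Finset.card_filter_add_card_filter_not (s := (Finset.univ : Finset (Fin n)))
      (fun t => u t ≠ 0)
    rw [Finset.card_univ, Fintype.card_fin] at this
    unfold wt
    omega
  rw [h4]
  rfl

theorem kraw {n : ℕ} (u : Fin n → ZMod 2) (i : ℕ) :
    ∑ v : Fin n → ZMod 2, (if wt v = i then chi2 (∑ t, u t * v t) else 0)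
      = ∑ s ∈ Finset.range (i + 1),
          (-1 : ℝ) ^ s * (Nat.choose (wt u) s : ℝ) * (Nat.choose (n - wt u) (i - s) : ℝ) := by
  have h := congrArg (fun p : Polynomial ℝ => p.coeff i) (gen_kraw u)
  simp only [Polynomial.finsetSum_coeff, Polynomial.coeff_C_mul, Polynomial.coeff_X_pow] at h
  simp only [Polynomial.coeff_mul, coeff_one_sub_X_pow', Polynomial.coeff_one_add_X_pow] at h
  rw [Finset.Nat.sum_antidiagonal_eq_sum_range_succ_mk] at h
  rw [← h]
  refine Finset.sum_congr rfl fun v _ => ?_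
  simp [eq_comm]

theorem orth {n k : ℕ} (C : Submodule (ZMod 2) (Fin n → ZMod 2))
    (hk : Module.finrank (ZMod 2) C = k) (v : Fin n → ZMod 2) [Decidable (v ∈ dualCode C)] :
    ∑ u : C, chi2 (∑ t, (u : Fin n → ZMod 2) t * v t) = if v ∈ dualCode C then 2 ^ k else 0 := by
  split_ifs with h
  · have h' : ∀ x ∈ C, ∑ i, x i * v i = 0 := h
    rw [Finset.sum_congr rfl (fun u _ => by rw [h' u u.2, chi2_zero])]
    have : Fintype.card C = 2 ^ k := by
      rw [Module.card_eq_pow_finrank (K := ZMod 2), hk, ZMod.card]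
    simp [this]
  · have h' : ¬ ∀ x ∈ C, ∑ i, x i * v i = 0 := h
    push Not at h'
    obtain ⟨x, hx, hne⟩ := h'
    have e := Equiv.sum_comp (Equiv.addRight (⟨x, hx⟩ : C))
      (fun u : C => chi2 (∑ t, (u : Fin n → ZMod 2) t * v t))
    have hm : chi2 (∑ i, x i * v i) = -1 := by simp [chi2, hne]
    simp only [Equiv.coe_addRight, Submodule.coe_add, Pi.add_apply, add_mul,
      Finset.sum_add_distrib, chi2_add, hm, ← Finset.sum_mul] at e
    linarith

theorem wdist_sum {n : ℕ} (D : Submodule (ZMod 2) (Fin n → ZMod 2)) (j : ℕ) :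
    (wdist D j : ℝ) = ∑ u : D, if wt (u : Fin n → ZMod 2) = j then 1 else 0 := by
  unfold wdist
  rw [Nat.card_eq_fintype_card, Fintype.card_subtype]
  simp

theorem stmt15 {n k : ℕ} (C : Submodule (ZMod 2) (Fin n → ZMod 2))
    (hk : Module.finrank (ZMod 2) C = k) (i : ℕ) (hi : i ≤ n) :
    (wdist (dualCode C) i : ℝ) =
      (1 / 2 ^ k) * ∑ j ∈ Finset.range (n + 1), (wdist C j : ℝ) *
        ∑ s ∈ Finset.range (i + 1),
          (-1 : ℝ) ^ s * (Nat.choose j s : ℝ) * (Nat.choose (n - j) (i - s) : ℝ) := by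
  classical
  have hR : ∀ f : ℕ → ℝ, ∑ j ∈ Finset.range (n + 1), (wdist C j : ℝ) * f j
      = ∑ u : C, f (wt (u : Fin n → ZMod 2)) := by
    intro f
    simp_rw [wdist_sum, Finset.sum_mul]
    rw [Finset.sum_comm]
    refine Finset.sum_congr rfl fun u _ => ?_
    have := wt_le' (u : Fin n → ZMod 2)
    simp only [ite_mul, one_mul, zero_mul, Finset.sum_ite_eq, Finset.mem_range]
    rw [if_pos (by omega)]
  rw [hR (fun j => ∑ s ∈ Finset.range (i + 1),
          (-1 : ℝ) ^ s * (Nat.choose j s : ℝ) * (Nat.choose (n - j) (i - s) : ℝ))]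
  simp_rw [← kraw]
  rw [Finset.sum_comm]
  have hL : ∀ v : Fin n → ZMod 2,
      ∑ u : C, (if wt v = i then chi2 (∑ t, (u : Fin n → ZMod 2) t * v t) else 0)
      = 2 ^ k * (if v ∈ dualCode C then (if wt v = i then 1 else 0) else 0) := by
    intro v
    by_cases h : wt v = i
    · simp only [h, if_true]
      rw [orth C hk v]
      simp
    · simp [h]
  simp_rw [hL]
  rw [← Finset.mul_sum, ← mul_assoc, one_div, inv_mul_cancel₀ (by positivity), one_mul, wdist_sum]
  symm
  rw [← Finset.sum_filter]
  exact Finset.sum_subtype (p := fun v => v ∈ dualCode C)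
    (Finset.univ.filter fun v => v ∈ dualCode C) (by intro x; simp)
    (fun v => if wt v = i then (1 : ℝ) else 0)
end
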